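/- Removable singularity for SK-metrics: let G ⊆ ℂ be a domain, z₀ ∈ G, and let λ : G → [0,∞) be continuous with λ ≢ 0. If λ restricted to G∖{z₀} induces an SK-metric on G∖{z₀}, i.e. Δ̲(log λ)(z) ≥ 4λ(z)² at every z ∈ G∖{z₀} with λ(z) > 0, then λ(z)|dz| is an SK-metric on G, i.e. the inequality Δ̲(log λ)(z) ≥ 4λ(z)² also holds at z₀ in case λ(z₀) > 0. -/

import Mathlib

open Complex MeasureTheory Metric Filter Set

noncomputable section

/-- The open unit disk in the complex plane. -/
def unitDisk : Set ℂ := Metric.ball 0 1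

/-- The generalized lower Laplace operator
`Δ̲u(z) = liminf_{r→0⁺} (4/r²) [(1/2π) ∫₀^{2π} u(z + re^{it}) dt − u(z)]`, valued in `EReal`. -/
def lowerLap (u : ℂ → ℝ) (z : ℂ) : EReal :=
  Filter.liminf
    (fun r : ℝ =>
      (((4 / r ^ 2) * ((1 / (2 * Real.pi)) *
          (∫ t in (0:ℝ)..(2 * Real.pi), u (z + (r : ℂ) * Complex.exp ((t : ℂ) * Complex.I)))
        - u z) : ℝ) : EReal))
    (nhdsWithin 0 (Set.Ioi 0))

/-- `lam` is (the density of) an SK-metric on `G`: continuous, nonnegative, not identically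
zero, and with generalized curvature at most `-4`, i.e. `Δ̲(log lam) ≥ 4 lam²` wherever
`lam > 0`. -/
def IsSKOn (lam : ℂ → ℝ) (G : Set ℂ) : Prop :=
  ContinuousOn lam G ∧ (∀ z ∈ G, 0 ≤ lam z) ∧ (∃ z ∈ G, lam z ≠ 0) ∧
  ∀ z ∈ G, 0 < lam z →
    ((4 * lam z ^ 2 : ℝ) : EReal) ≤ lowerLap (fun w => Real.log (lam w)) z

open Real in
lemma sk_trig_span (g : C(AddCircle (2 * Real.pi), ℂ))
    (hg : g ∈ Submodule.span ℂ (Set.range (@fourier (2 * Real.pi)))) :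
    ∃ F₁ F₂ : ℂ → ℂ, Differentiable ℂ F₁ ∧ Differentiable ℂ F₂ ∧
      ∀ θ : ℝ, g (θ : AddCircle (2 * Real.pi)) = F₁ (Complex.exp (θ * Complex.I)) +
        (starRingEnd ℂ) (F₂ (Complex.exp (θ * Complex.I))) := by
  induction hg using Submodule.span_induction with
  | mem x hx =>
    obtain ⟨n, rfl⟩ := hx
    have key : ∀ θ : ℝ, fourier n (θ : AddCircle (2 * Real.pi)) =
        Complex.exp (n * (θ * Complex.I)) := by
      intro θ
      rw [fourier_coe_apply]
      congr 1
      have : (Real.pi : ℂ) ≠ 0 := by exact_mod_cast Real.pi_ne_zero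
      push_cast
      field_simp
    obtain ⟨m, rfl | rfl⟩ := n.eq_nat_or_neg
    · refine ⟨fun z => z ^ m, fun _ => 0, by fun_prop, by fun_prop, fun θ => ?_⟩
      rw [key]
      beta_reduce
      rw [← Complex.exp_nat_mul]
      simp
    · refine ⟨fun _ => 0, fun z => z ^ m, by fun_prop, by fun_prop, fun θ => ?_⟩
      rw [key]
      beta_reduce
      rw [← Complex.exp_nat_mul, ← Complex.exp_conj]
      simp
  | zero => exact ⟨fun _ => 0, fun _ => 0, by fun_prop, by fun_prop, by simp⟩
  | add x y _ _ hx hy =>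
    obtain ⟨F₁, F₂, h1, h2, h3⟩ := hx
    obtain ⟨G₁, G₂, k1, k2, k3⟩ := hy
    refine ⟨fun z => F₁ z + G₁ z, fun z => F₂ z + G₂ z, by fun_prop, by fun_prop, fun θ => ?_⟩
    rw [ContinuousMap.add_apply, h3, k3, map_add]
    ring
  | smul a x _ hx =>
    obtain ⟨F₁, F₂, h1, h2, h3⟩ := hx
    refine ⟨fun z => a * F₁ z, fun z => (starRingEnd ℂ) a * F₂ z, by fun_prop, by fun_prop,
      fun θ => ?_⟩
    rw [ContinuousMap.smul_apply, h3, map_mul, smul_eq_mul, Complex.conj_conj]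
    ring

lemma sk_approx (v : ℂ → ℝ) (z₀ : ℂ) (R : ℝ) (hR : 0 < R)
    (hv : ContinuousOn v (sphere z₀ R)) (δ : ℝ) (hδ : 0 < δ) :
    ∃ F : ℂ → ℂ, Differentiable ℂ F ∧ ∀ z ∈ sphere z₀ R, |v z - (F z).re| ≤ δ := by
  have : Fact (0 < 2 * Real.pi) := ⟨Real.two_pi_pos⟩
  have hcont : Continuous (fun x : AddCircle (2 * Real.pi) =>
      ((v (z₀ + R * (AddCircle.toCircle x : ℂ)) : ℝ) : ℂ)) := by
    refine Complex.continuous_ofReal.comp (hv.comp_continuous ?_ ?_)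
    · have := AddCircle.continuous_toCircle (T := 2 * Real.pi)
      fun_prop
    · intro x
      have := Circle.norm_coe (AddCircle.toCircle x)
      simp [abs_of_pos hR, this]
  let f : C(AddCircle (2 * Real.pi), ℂ) := ⟨_, hcont⟩
  have hf : f ∈ (Submodule.span ℂ (Set.range (@fourier (2 * Real.pi)))).topologicalClosure := by
    rw [span_fourier_closure_eq_top]; trivial
  rw [← SetLike.mem_coe, Submodule.topologicalClosure_coe, Metric.mem_closure_iff] at hf
  obtain ⟨g, hg, hfg⟩ := hf δ hδ
  obtain ⟨F₁, F₂, h1, h2, h3⟩ := sk_trig_span g hg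
  refine ⟨fun z => F₁ ((z - z₀) / R) + F₂ ((z - z₀) / R), by fun_prop, fun z hz => ?_⟩
  have hz' : z ∈ sphere z₀ |R| := by rwa [abs_of_pos hR]
  rw [← range_circleMap] at hz'
  obtain ⟨θ, rfl⟩ := hz'
  have hRc : (R : ℂ) ≠ 0 := by exact_mod_cast hR.ne'
  have e : (circleMap z₀ R θ - z₀) / R = Complex.exp (θ * Complex.I) := by
    simp [circleMap, hRc]
  have hd := (ContinuousMap.dist_apply_le_dist (f := f) (g := g)
    (θ : AddCircle (2 * Real.pi))).trans hfg.le
  rw [dist_eq_norm, h3] at hd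
  have hd2 := (Complex.abs_re_le_norm _).trans hd
  have ef : f (θ : AddCircle (2 * Real.pi)) = ((v (circleMap z₀ R θ) : ℝ) : ℂ) := by
    change ((v (z₀ + R * (AddCircle.toCircle (θ : AddCircle (2 * Real.pi)) : ℂ)) : ℝ) : ℂ) = _
    rw [AddCircle.toCircle_apply_mk]
    simp [circleMap, Real.pi_ne_zero]
  rw [ef] at hd2
  beta_reduce
  rw [e]
  simpa using hd2

open Real InnerProductSpace in
lemma sk_max (v : ℂ → ℝ) (z₀ : ℂ) (R : ℝ) (hR : 0 < R)
    (hv : ContinuousOn v (closedBall z₀ R))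
    (H : ∀ w ∈ ball z₀ R, w ≠ z₀ → ∀ᶠ r in nhdsWithin (0:ℝ) (Set.Ioi 0),
      v w < Real.circleAverage v w r)
    (F : ℂ → ℂ) (hF : Differentiable ℂ F) (δ : ℝ) (hδ : 0 < δ)
    (hb : ∀ z ∈ sphere z₀ R, |v z - (F z).re| ≤ δ) (ε : ℝ) (hε : 0 < ε)
    (w : ℂ) (hw : w ∈ ball z₀ R) (hw0 : w ≠ z₀) :
    v w - (F w).re + ε * Real.log (‖w - z₀‖ / R) ≤ δ := by
  by_contra! hlt
  have hFc : Continuous fun z => (F z).re := Complex.continuous_re.comp hF.continuous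
  have hvF : ContinuousOn (fun z => v z - (F z).re) (closedBall z₀ R) := hv.sub hFc.continuousOn
  obtain ⟨M, hM⟩ := ((isCompact_closedBall z₀ R).image_of_continuousOn hvF).bddAbove
  have hM' : ∀ z ∈ closedBall z₀ R, v z - (F z).re ≤ M := fun z hz => hM ⟨z, hz, rfl⟩
  have hwpos : 0 < ‖w - z₀‖ := norm_pos_iff.2 (sub_ne_zero.2 hw0)
  obtain ⟨s, hs0, hsw, hsM⟩ : ∃ s, 0 < s ∧ s < ‖w - z₀‖ ∧ M + ε * Real.log (s / R) ≤ δ := by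
    refine ⟨min (‖w - z₀‖ / 2) (R * Real.exp ((δ - M) / ε)), by positivity, ?_, ?_⟩
    · exact (min_le_left _ _).trans_lt (by linarith)
    · have : Real.log (min (‖w - z₀‖ / 2) (R * Real.exp ((δ - M) / ε)) / R) ≤ (δ - M) / ε := by
        rw [Real.log_le_iff_le_exp (by positivity), div_le_iff₀ hR, mul_comm]
        exact min_le_right _ _
      have := mul_le_mul_of_nonneg_left this hε.le
      rw [mul_div_cancel₀ _ hε.ne'] at this
      linarith
  set K : Set ℂ := closedBall z₀ R \ ball z₀ s with hK
  have hKc : IsCompact K := (isCompact_closedBall z₀ R).diff isOpen_ball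
  have hK0 : ∀ z ∈ K, z - z₀ ≠ 0 := by
    rintro z ⟨_, hz⟩ h0
    apply hz
    rw [mem_ball, dist_eq_norm, h0]; simpa using hs0
  set L : ℂ → ℝ := fun z => Real.log (‖z - z₀‖ / R) with hL
  have hLc : ContinuousOn L K := by
    apply ContinuousOn.log
    · fun_prop
    · intro z hz
      exact div_ne_zero (norm_ne_zero_iff.2 (hK0 z hz)) hR.ne'
  have hΦ : ContinuousOn (fun z => v z - (F z).re + ε * L z) K :=
    (hvF.mono sdiff_subset).add (continuousOn_const.mul hLc)
  have hwK : w ∈ K := ⟨ball_subset_closedBall hw, by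
    rw [mem_ball, dist_eq_norm]; exact not_lt.2 hsw.le⟩
  obtain ⟨p, hpK, hpmax⟩ := hKc.exists_isMaxOn ⟨w, hwK⟩ hΦ
  have hpw : δ < v p - (F p).re + ε * L p := hlt.trans_le (hpmax hwK)
  have hpR : ‖p - z₀‖ < R := by
    refine lt_of_le_of_ne (by simpa [dist_eq_norm] using hpK.1) fun h => ?_
    have h1 := (abs_le.1 (hb p (by simpa [dist_eq_norm] using h))).2
    simp only [hL, h, div_self hR.ne', Real.log_one] at hpw
    linarith
  have hps : s < ‖p - z₀‖ := by
    refine lt_of_le_of_ne (by simpa [dist_eq_norm] using hpK.2) fun h => ?_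
    have h1 := hM' p hpK.1
    simp only [hL, ← h] at hpw
    linarith
  have hp0 : p ≠ z₀ := sub_ne_zero.1 (hK0 p hpK)
  have hsmall : ∀ᶠ r in nhdsWithin (0:ℝ) (Set.Ioi 0),
      r < min (R - ‖p - z₀‖) (‖p - z₀‖ - s) :=
    (eventually_lt_nhds (lt_min (by linarith) (by linarith))).filter_mono nhdsWithin_le_nhds
  obtain ⟨r, hr1, hr2, hr0⟩ := ((H p (by simpa [dist_eq_norm] using hpR) hp0).and
    (hsmall.and self_mem_nhdsWithin)).exists
  obtain ⟨hr3, hr4⟩ := lt_min_iff.1 hr2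
  have hsub : closedBall p |r| ⊆ K := by
    intro z hz
    rw [abs_of_pos hr0, mem_closedBall, dist_eq_norm] at hz
    have t1 : ‖z - z₀‖ ≤ ‖z - p‖ + ‖p - z₀‖ := norm_sub_le_norm_sub_add_norm_sub z p z₀
    have t2 : ‖p - z₀‖ ≤ ‖p - z‖ + ‖z - z₀‖ := norm_sub_le_norm_sub_add_norm_sub p z z₀
    rw [norm_sub_rev p z] at t2
    refine ⟨by rw [mem_closedBall, dist_eq_norm]; linarith, ?_⟩
    rw [mem_ball, dist_eq_norm]; linarith
  have hsph : sphere p |r| ⊆ K := sphere_subset_closedBall.trans hsub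
  have iv : CircleIntegrable v p r :=
    ((hv.mono sdiff_subset).mono hsph).circleIntegrable'
  have iF : CircleIntegrable (fun z => (F z).re) p r := hFc.continuousOn.circleIntegrable'
  have iL : CircleIntegrable (fun z => ε * L z) p r :=
    (continuousOn_const.mul (hLc.mono hsph)).circleIntegrable'
  have aF : Real.circleAverage (fun z => (F z).re) p r = (F p).re := by
    apply InnerProductSpace.HarmonicOnNhd.circleAverage_eq
    intro z _
    exact (hF.analyticAt z).harmonicAt_re
  have aL : Real.circleAverage (fun z => ε * L z) p r = ε * L p := by
    have : Real.circleAverage L p r = L p := by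
      apply InnerProductSpace.HarmonicOnNhd.circleAverage_eq
      intro z hz
      have hz0 := hK0 z (hsub hz)
      have hRc : (R : ℂ) ≠ 0 := by exact_mod_cast hR.ne'
      have := AnalyticAt.harmonicAt_log_norm (f := fun z : ℂ => (z - z₀) / R) (z := z)
        (by fun_prop (disch := exact hRc)) (div_ne_zero hz0 hRc)
      simpa [hL, abs_of_pos hR] using this
    rw [← smul_eq_mul, ← this, ← Real.circleAverage_fun_smul]
    rfl
  have iD : CircleIntegrable (fun z => v z - (F z).re) p r := iv.sub iF
  have aΦ : Real.circleAverage (fun z => v z - (F z).re + ε * L z) p r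
      = Real.circleAverage v p r - (F p).re + ε * L p := by
    rw [Real.circleAverage_fun_add iD iL, Real.circleAverage_fun_sub iv iF, aF, aL]
  have hle := Real.circleAverage_mono_on_of_le_circle ((iv.sub iF).add iL)
    (fun z hz => hpmax (hsph hz))
  have hle' : Real.circleAverage (fun z => v z - (F z).re + ε * L z) p r
    ≤ v p - (F p).re + ε * L p := hle
  rw [aΦ] at hle'
  linarith

lemma sk_subharm (v : ℂ → ℝ) (z₀ : ℂ) (R : ℝ) (hR : 0 < R)
    (hv : ContinuousOn v (closedBall z₀ R))
    (H : ∀ w ∈ ball z₀ R, w ≠ z₀ → ∀ᶠ r in nhdsWithin (0:ℝ) (Set.Ioi 0),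
      v w < Real.circleAverage v w r) :
    v z₀ ≤ Real.circleAverage v z₀ R := by
  have hsph : ContinuousOn v (sphere z₀ R) := hv.mono sphere_subset_closedBall
  apply le_of_forall_pos_le_add
  intro η hη
  obtain ⟨F, hF, hb⟩ := sk_approx v z₀ R hR hsph (η / 2) (by positivity)
  have hFc : Continuous fun z => (F z).re := Complex.continuous_re.comp hF.continuous
  have h1 : ∀ w ∈ ball z₀ R, w ≠ z₀ → v w - (F w).re ≤ η / 2 := by
    intro w hw hw0
    have key : ∀ ε > 0, v w - (F w).re + ε * Real.log (‖w - z₀‖ / R) ≤ η / 2 := fun ε hε =>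
      sk_max v z₀ R hR hv H F hF (η / 2) (by positivity) hb ε hε w hw hw0
    have ht : Tendsto (fun ε : ℝ => v w - (F w).re + ε * Real.log (‖w - z₀‖ / R))
        (nhdsWithin 0 (Set.Ioi 0)) (nhds (v w - (F w).re + 0 * Real.log (‖w - z₀‖ / R))) :=
      ((by fun_prop : Continuous fun ε : ℝ =>
        v w - (F w).re + ε * Real.log (‖w - z₀‖ / R)).tendsto 0).mono_left nhdsWithin_le_nhds
    have := le_of_tendsto ht (eventually_mem_nhdsWithin.mono fun ε hε => key ε hε)
    simpa using this
  have h2 : v z₀ - (F z₀).re ≤ η / 2 := by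
    have hc : ContinuousAt (fun z => v z - (F z).re) z₀ :=
      (hv.sub hFc.continuousOn).continuousAt (closedBall_mem_nhds z₀ hR)
    have ht : Tendsto (fun z => v z - (F z).re) (nhdsWithin z₀ {z₀}ᶜ) (nhds (v z₀ - (F z₀).re)) :=
      hc.tendsto.mono_left nhdsWithin_le_nhds
    refine le_of_tendsto ht ?_
    filter_upwards [eventually_mem_nhdsWithin, nhdsWithin_le_nhds (ball_mem_nhds z₀ hR)] with z hz hz'
    exact h1 z hz' hz
  have aF : Real.circleAverage (fun z => (F z).re) z₀ R = (F z₀).re := by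
    apply InnerProductSpace.HarmonicOnNhd.circleAverage_eq
    intro z _
    exact (hF.analyticAt z).harmonicAt_re
  have iv : CircleIntegrable v z₀ R := hsph.circleIntegrable hR.le
  have iF : CircleIntegrable (fun z => (F z).re) z₀ R := hFc.continuousOn.circleIntegrable'
  have h3 : Real.circleAverage (fun z => (F z).re - v z) z₀ R ≤ η / 2 := by
    apply Real.circleAverage_mono_on_of_le_circle (iF.sub iv)
    intro z hz
    rw [abs_of_pos hR] at hz
    have := (abs_le.1 (hb z hz)).1
    change (F z).re - v z ≤ _
    linarith
  rw [Real.circleAverage_fun_sub iF iv, aF] at h3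
  linarith

lemma sk_avg_sq (z₀ w : ℂ) (r : ℝ) :
    Real.circleAverage (fun z => ‖z - z₀‖ ^ 2) w r = ‖w - z₀‖ ^ 2 + r ^ 2 := by
  let P : ℂ → ℂ := fun z => ((‖w - z₀‖ ^ 2 + r ^ 2 : ℝ) : ℂ) +
    2 * (starRingEnd ℂ) (w - z₀) * (z - w)
  have hP : Differentiable ℂ P := by fun_prop
  have e : Real.circleAverage (fun z => ‖z - z₀‖ ^ 2) w r
      = Real.circleAverage (fun z => (P z).re) w r := by
    apply Real.circleAverage_congr_sphere
    intro z hz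
    have hz' : ‖z - w‖ ^ 2 = r ^ 2 := by
      rw [← sq_abs r, ← mem_sphere_iff_norm.1 hz]
    simp only [P]
    rw [← hz']
    simp only [← Complex.normSq_eq_norm_sq, Complex.normSq_apply]
    simp
    ring
  rw [e, InnerProductSpace.HarmonicOnNhd.circleAverage_eq
    (fun z _ => (hP.analyticAt z).harmonicAt_re)]
  simp [P, ← Complex.ofReal_pow]

lemma sk_lowerLap_eq (u : ℂ → ℝ) (z : ℂ) : lowerLap u z = Filter.liminf
    (fun r : ℝ => (((4 / r ^ 2) * (Real.circleAverage u z r - u z) : ℝ) : EReal))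
    (nhdsWithin 0 (Set.Ioi 0)) := by
  unfold lowerLap
  simp [Real.circleAverage_def, circleMap]

/-- removable singularity for SK-metrics: if a continuous nonnegative
density `lam ≢ 0` on a domain `G` induces an SK-metric on `G ∖ {z₀}`, then it is an
SK-metric on all of `G`, i.e. the curvature inequality also holds at `z₀`. -/
theorem sk_metric_removable_singularity (G : Set ℂ) (hGo : IsOpen G)
    (hGc : IsConnected G) (z₀ : ℂ) (hz₀ : z₀ ∈ G)
    (lam : ℂ → ℝ) (hcont : ContinuousOn lam G) (hpos : ∀ z ∈ G, 0 ≤ lam z)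
    (hne : ∃ z ∈ G, lam z ≠ 0)
    (hSK : ∀ z ∈ G \ {z₀}, 0 < lam z →
      ((4 * lam z ^ 2 : ℝ) : EReal) ≤ lowerLap (fun w => Real.log (lam w)) z) :
    ∀ z ∈ G, 0 < lam z →
      ((4 * lam z ^ 2 : ℝ) : EReal) ≤ lowerLap (fun w => Real.log (lam w)) z := by
  intro z hz hlz
  by_cases hzz : z ≠ z₀
  · exact hSK z ⟨hz, hzz⟩ hlz
  push Not at hzz
  subst hzz
  set u : ℂ → ℝ := fun w => Real.log (lam w) with hu
  refine EReal.ge_of_forall_gt_iff_ge.1 ?_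
  intro c hc
  have hc' : c < 4 * lam z ^ 2 := by exact_mod_cast hc
  have hca : ContinuousAt lam z := hcont.continuousAt (hGo.mem_nhds hz)
  have hev : ∀ᶠ w in nhds z, w ∈ G ∧ 0 < lam w ∧ c < 4 * lam w ^ 2 :=
    (hGo.eventually_mem hz).and ((hca.eventually (lt_mem_nhds hlz)).and
      (((hca.pow 2).const_mul 4).eventually (lt_mem_nhds hc')))
  obtain ⟨ρ, hρ, hball⟩ := Metric.eventually_nhds_iff_ball.1 hev
  rw [sk_lowerLap_eq]
  refine Filter.le_liminf_of_le (by isBoundedDefault) ?_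
  have hsmall : ∀ᶠ r in nhdsWithin (0:ℝ) (Set.Ioi 0), r < ρ :=
    (eventually_lt_nhds hρ).filter_mono nhdsWithin_le_nhds
  have hucont : ContinuousOn u (ball z ρ) := fun w hw =>
    ((hcont.continuousAt (hGo.mem_nhds (hball w hw).1)).log
      (hball w hw).2.1.ne').continuousWithinAt
  have havg : ∀ w r, sphere w |r| ⊆ ball z ρ →
      Real.circleAverage (fun x => u x - c / 4 * ‖x - z‖ ^ 2) w r =
        Real.circleAverage u w r - c / 4 * (‖w - z‖ ^ 2 + r ^ 2) := by
    intro w r hs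
    rw [Real.circleAverage_fun_sub (hucont.mono hs).circleIntegrable'
      (Continuous.continuousOn (by fun_prop)).circleIntegrable', ← sk_avg_sq z w r]
    congr 1
    rw [← smul_eq_mul, ← Real.circleAverage_fun_smul]
    rfl
  filter_upwards [hsmall, self_mem_nhdsWithin] with r hr hr0
  rw [Set.mem_Ioi] at hr0
  have hcb : closedBall z r ⊆ ball z ρ := closedBall_subset_ball hr
  have main := sk_subharm (fun x => u x - c / 4 * ‖x - z‖ ^ 2) z r hr0
    ((hucont.mono hcb).sub (Continuous.continuousOn (by fun_prop))) ?_
  · rw [havg z r (by rw [abs_of_pos hr0]; exact sphere_subset_closedBall.trans hcb)] at main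
    simp only [sub_self, norm_zero] at main
    have h4 : c / 4 * r ^ 2 ≤ Real.circleAverage u z r - u z := by linarith
    have : c ≤ 4 / r ^ 2 * (Real.circleAverage u z r - u z) := by
      rw [div_mul_eq_mul_div, le_div_iff₀ (by positivity)]
      linarith
    exact_mod_cast this
  · intro w hw hw0
    have hwρ : w ∈ ball z ρ := ball_subset_ball hr.le hw
    obtain ⟨hwG, hwl, hwc⟩ := hball w hwρ
    have h := hSK w ⟨hwG, hw0⟩ hwl
    rw [sk_lowerLap_eq] at h
    have hlt : (c : EReal) < Filter.liminf
        (fun r : ℝ => (((4 / r ^ 2) * (Real.circleAverage u w r - u w) : ℝ) : EReal))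
        (nhdsWithin 0 (Set.Ioi 0)) := lt_of_lt_of_le (by exact_mod_cast hwc) h
    have hlt' := Filter.eventually_lt_of_lt_liminf hlt (by isBoundedDefault)
    have hs2 : ∀ᶠ s in nhdsWithin (0:ℝ) (Set.Ioi 0), s < ρ - dist w z :=
      (eventually_lt_nhds (by rw [mem_ball] at hwρ; linarith)).filter_mono nhdsWithin_le_nhds
    filter_upwards [hlt', hs2, self_mem_nhdsWithin] with s h1 h2 h3
    rw [Set.mem_Ioi] at h3
    have h1' : c < 4 / s ^ 2 * (Real.circleAverage u w s - u w) := by exact_mod_cast h1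
    rw [div_mul_eq_mul_div, lt_div_iff₀ (by positivity)] at h1'
    rw [havg w s]
    · linarith
    · rw [abs_of_pos h3]
      exact sphere_subset_closedBall.trans (closedBall_subset_ball' (by linarith))
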